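/- For every k ≥ 1, the naturally grown forest f_k = 𝔑^{k−1}(•) ∈ k{T} is an eigenvector of 𝔓∘𝔑 with eigenvalue C(k+1,2): that is, 𝔓(𝔑^k(•)) = C(k+1,2) · 𝔑^{k−1}(•), where C(k+1,2) is the binomial coefficient. -/

import Mathlib

attribute [local instance] Classical.propDecidable

inductive PlanarTree : Type where
  | node : List PlanarTree → PlanarTree

namespace PlanarTree

/-- Isomorphism of (planar representatives of) rooted trees: the lists of
principal branches match up, pairwise isomorphically, after a permutation. -/
inductive Iso : PlanarTree → PlanarTree → Prop where
  | node {l m l' : List PlanarTree} :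
      List.Perm l m → List.Forall₂ Iso m l' → Iso (node l) (node l')

/-- Number of vertices. -/
def size : PlanarTree → ℕ
  | node l => 1 + (l.attach.map fun c => size c.1).sum
decreasing_by simp only [PlanarTree.node.sizeOf_spec]; exact Nat.lt_of_lt_of_le (List.sizeOf_lt_of_mem c.2) (Nat.le_add_left _ _)

mutual
  /-- All trees obtained by attaching the root of `s` by a new edge to some vertex. -/
  def graftList (s : PlanarTree) : PlanarTree → List PlanarTree
    | node l => node (s :: l) :: (graftAux s l).map node
  def graftAux (s : PlanarTree) : List PlanarTree → List (List PlanarTree)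
    | [] => []
    | a :: l => ((graftList s a).map (· :: l)) ++ (graftAux s l).map (a :: ·)
end

/-- All trees obtained by adding a new edge and terminal vertex at some vertex. -/
def growList (t : PlanarTree) : List PlanarTree := graftList (node []) t

mutual
  /-- All trees obtained by deleting one (non-root) terminal vertex. -/
  def pruneList : PlanarTree → List PlanarTree
    | node l => (pruneAux l).map node
  def pruneAux : List PlanarTree → List (List PlanarTree)
    | [] => []
    | a :: l =>
        (match a with | node [] => [l] | _ => []) ++
        ((pruneList a).map (· :: l)) ++ (pruneAux l).map (a :: ·)
end

mutual
  /-- All pairs (cut-off subtree, remaining tree) obtained by cutting one edge. -/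
  def cutPairs : PlanarTree → List (PlanarTree × PlanarTree)
    | node l => (cutAux l).map fun x => (x.1, node x.2)
  def cutAux : List PlanarTree → List (PlanarTree × List PlanarTree)
    | [] => []
    | a :: l =>
        (a, l) :: (((cutPairs a).map fun x => (x.1, x.2 :: l)) ++
          (cutAux l).map fun x => (x.1, a :: x.2))
end

/-- The order of the symmetry group `SG(t)`: the product over all vertices `v`
of the number of permutations of the branches at `v` exchanging isomorphic branches. -/
noncomputable def sg : PlanarTree → ℕ
  | node l =>
      (l.attach.map fun c => sg c.1).prod *
        Nat.card {σ : Equiv.Perm (Fin l.length) // ∀ i, Iso (l.get (σ i)) (l.get i)}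
decreasing_by simp only [PlanarTree.node.sizeOf_spec]; exact Nat.lt_of_lt_of_le (List.sizeOf_lt_of_mem c.2) (Nat.le_add_left _ _)

/-- Vertices of a planar tree, encoded as paths of child-indices from the root. -/
inductive IsVertex : PlanarTree → List ℕ → Prop where
  | root (t : PlanarTree) : IsVertex t []
  | child {l : List PlanarTree} {i : ℕ} {c : PlanarTree} {p : List ℕ} :
      l[i]? = some c → IsVertex c p → IsVertex (node l) (i :: p)

def Vertex (t : PlanarTree) : Type := {p : List ℕ // IsVertex t p}

/-- `v` lies strictly below `w` in the tree order (i.e. `w` is a proper ancestor of `v`). -/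
def StrictBelow {t : PlanarTree} (v w : Vertex t) : Prop := w.1 <+: v.1 ∧ w.1 ≠ v.1

/-- A labelling of `t`. -/
def Labelling (t : PlanarTree) : Type :=
  {f : Vertex t ≃ Fin t.size // ∀ v w, StrictBelow v w → f w < f v}

/-- Equivalence of labellings: they differ by an automorphism of the rooted tree. -/
def labelEquiv {t : PlanarTree} (f g : Labelling t) : Prop :=
  ∃ φ : Equiv.Perm (Vertex t),
    (∀ v w, StrictBelow (φ v) (φ w) ↔ StrictBelow v w) ∧ ∀ v, f.1 (φ v) = g.1 v

end PlanarTree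

/-- Rooted trees: isomorphism classes of planar rooted trees. -/
instance planarSetoid : Setoid PlanarTree := Relation.EqvGen.setoid PlanarTree.Iso

def RTree : Type := Quotient planarSetoid

namespace RTree

def mk (p : PlanarTree) : RTree := ⟦p⟧

/-- A chosen planar representative. -/
noncomputable def rep (T : RTree) : PlanarTree := Quotient.out T

noncomputable def size (T : RTree) : ℕ := T.rep.size

/-- The order of the symmetry (automorphism) group of `T`. -/
noncomputable def sg (T : RTree) : ℕ := T.rep.sg

/-- The one-vertex tree. -/
def bullet : RTree := mk (PlanarTree.node [])

/-- `Covers T T'` means `T ⊲ T'`: `T` is obtained from `T'` by deleting one terminal vertex. -/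
noncomputable def Covers (T T' : RTree) : Prop :=
  ∃ p ∈ T'.rep.pruneList, mk p = T

/-- `n(T;T')`: the number of vertices of `T` to which a new edge can be added to obtain `T'`. -/
noncomputable def nCov (T T' : RTree) : ℕ :=
  T.rep.growList.countP fun p => decide (mk p = T')

/-- `m(T;T')`: the number of (terminal) edges of `T'` which when removed leave `T`. -/
noncomputable def mCov (T T' : RTree) : ℕ :=
  T'.rep.pruneList.countP fun p => decide (mk p = T)

/-- `n(T₁,T₂;T₃)`: the number of vertices of `T₂` such that attaching the root of `T₁`
there by a new edge yields `T₃`. -/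
noncomputable def nTri (T₁ T₂ T₃ : RTree) : ℕ :=
  (PlanarTree.graftList T₁.rep T₂.rep).countP fun p => decide (mk p = T₃)

/-- `m(T₁,T₂;T₃)`: the number of edges of `T₃` whose removal cuts off a subtree
isomorphic to `T₁` leaving `T₂` (the piece containing the root). -/
noncomputable def mTri (T₁ T₂ T₃ : RTree) : ℕ :=
  T₃.rep.cutPairs.countP fun x => decide (mk x.1 = T₁ ∧ mk x.2 = T₂)

end RTree

section Ops

variable (k : Type*) [Semiring k]

/-- The element `𝔑(T) = Σ_{T ⊲ T'} n(T;T')·T'` of `k{T}`. -/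
noncomputable def growF (T : RTree) : RTree →₀ k :=
  (T.rep.growList.map fun p => Finsupp.single (RTree.mk p) (1 : k)).sum

/-- The element `𝔓(T) = Σ_{T' ⊲ T} m(T';T)·T'` of `k{T}`. -/
noncomputable def pruneF (T : RTree) : RTree →₀ k :=
  (T.rep.pruneList.map fun p => Finsupp.single (RTree.mk p) (1 : k)).sum

/-- The growth operator `𝔑` on `k{T}`. -/
noncomputable def Grow : Module.End k (RTree →₀ k) :=
  Finsupp.linearCombination k (growF k)

/-- The pruning operator `𝔓` on `k{T}`. -/
noncomputable def Prune : Module.End k (RTree →₀ k) :=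
  Finsupp.linearCombination k (pruneF k)

/-- The operator `𝔇` on `k{T}`, `𝔇(t) = |t|·t`. -/
noncomputable def Diag : Module.End k (RTree →₀ k) :=
  Finsupp.linearCombination k fun T => (T.size : k) • Finsupp.single T 1

/-- The inner product on `k{T}` determined by `(t,t') = |SG(t)|·δ_{t,t'}`. -/
noncomputable def innerT (x y : RTree →₀ k) : k :=
  x.sum fun T c => c * y T * (T.sg : k)

/-- Generalized multiplicity `n(T;T')`: coefficient of `T'` in `𝔑^{|T'|-|T|}(T)`. -/
noncomputable def nGen (T T' : RTree) : k :=
  ((Grow k ^ (T'.size - T.size)) (Finsupp.single T 1)) T'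

/-- Generalized multiplicity `m(T;T')`: coefficient of `T` in `𝔓^{|T'|-|T|}(T')`. -/
noncomputable def mGen (T T' : RTree) : k :=
  ((Prune k ^ (T'.size - T.size)) (Finsupp.single T' 1)) T

end Ops

section Kreimer

variable (k : Type*) [CommSemiring k]

/-- Kreimer's Hopf algebra `H_K`, as a commutative algebra: the free polynomial
algebra on rooted trees. -/
abbrev HK := MvPolynomial RTree k

/-- The inclusion `k{T} → H_K` of the linear span of the variables. -/
noncomputable def toHK : (RTree →₀ k) →ₗ[k] HK k :=
  Finsupp.linearCombination k fun T => MvPolynomial.X T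

/-- The growth derivation `N` on `H_K`, with `N(t) = 𝔑(t)` for rooted trees `t`. -/
noncomputable def ND : Derivation k (HK k) (HK k) :=
  MvPolynomial.mkDerivation k fun T => toHK k (growF k T)

/-- The pruning derivation `P` on `H_K`, with `P(t) = 𝔓(t)` for `|t| ≥ 2`, `P(•) = 1`. -/
noncomputable def PD : Derivation k (HK k) (HK k) :=
  MvPolynomial.mkDerivation k fun T =>
    if T = RTree.bullet then 1 else toHK k (pruneF k T)

/-- The grading derivation `D` on `H_K`, multiplying each homogeneous element of
degree `n` by `n`; it is the derivation with `D(t) = |t|·t` for rooted trees `t`. -/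
noncomputable def DD : Derivation k (HK k) (HK k) :=
  MvPolynomial.mkDerivation k fun T => (T.size : k) • MvPolynomial.X T

/-- The map `B₊ : H_K → k{T}` sending a forest to the tree obtained by attaching
all its roots to a new root vertex. -/
noncomputable def forestTree (d : RTree →₀ ℕ) : RTree :=
  RTree.mk (PlanarTree.node
    (d.support.toList.flatMap fun T => List.replicate (d T) T.rep))

noncomputable def Bplus (p : HK k) : RTree →₀ k :=
  ∑ d ∈ p.support, Finsupp.single (forestTree d) (MvPolynomial.coeff d p)

/-- The inner product on `H_K`. -/
noncomputable def innerHK (u v : HK k) : k := innerT k (Bplus k u) (Bplus k v)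

/-- The degree-`n` homogeneous component of `H_K`. -/
noncomputable abbrev HKcomp (n : ℕ) : Submodule k (HK k) :=
  MvPolynomial.weightedHomogeneousSubmodule k (fun T : RTree => T.size) n

/-- `T_i`: the number of rooted trees with `i+1` vertices. -/
noncomputable def Tcard (i : ℕ) : ℕ := Nat.card {T : RTree // T.size = i + 1}

end Kreimer

namespace PlanarTree

theorem size_node (l : List PlanarTree) : size (node l) = 1 + (l.map size).sum := by
  rw [size, List.attach_map_val]

theorem ne_nil_of_mem_graftAux {s : PlanarTree} {l m : List PlanarTree}
    (h : m ∈ graftAux s l) : m ≠ [] := by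
  cases l with
  | nil => simp [graftAux] at h
  | cons a l =>
    simp only [graftAux, List.mem_append, List.mem_map] at h
    rcases h with ⟨_, _, rfl⟩ | ⟨_, _, rfl⟩ <;> simp

theorem ne_leaf_of_mem_graftList {s t u : PlanarTree} (h : u ∈ graftList s t) :
    u ≠ node [] := by
  obtain ⟨l⟩ := t
  simp only [graftList, List.mem_cons, List.mem_map] at h
  rcases h with rfl | ⟨m, hm, rfl⟩
  · simp
  · simpa using ne_nil_of_mem_graftAux hm

theorem pruneAux_cons (a : PlanarTree) (l : List PlanarTree) :
    pruneAux (a :: l) = (if a = node [] then [l] else []) ++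
      ((pruneList a).map (· :: l)) ++ (pruneAux l).map (a :: ·) := by
  obtain ⟨_ | ⟨b, m⟩⟩ := a <;> simp [pruneAux]

section Commutator

variable {M : Type*} [AddCommMonoid M]

mutual
  /-- The commutation relation between pruning and growing, for trees. -/
  theorem sum_prune_grow (F : PlanarTree → M) : ∀ t : PlanarTree,
      ((growList t).map fun q => ((pruneList q).map F).sum).sum =
        ((pruneList t).map fun q => ((growList q).map F).sum).sum + t.size • F t
    | node l => by
      have h := sum_pruneAux_graftAux (fun m => F (node m)) l
      simp only [growList, graftList, pruneList, List.map_cons, List.map_map, List.sum_cons,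
        Function.comp_def, size_node, List.map_append, List.sum_append,
        pruneAux, List.map_nil, List.sum_nil, add_smul, one_smul, List.sum_map_add] at h ⊢
      rw [h]
      simp only [add_zero]
      abel
  /-- The commutation relation between pruning and growing, for forests. -/
  theorem sum_pruneAux_graftAux (F : List PlanarTree → M) : ∀ l : List PlanarTree,
      ((graftAux (node []) l).map fun q => ((pruneAux q).map F).sum).sum =
        ((pruneAux l).map fun q => ((graftAux (node []) q).map F).sum).sum +
          (l.map size).sum • F l
    | [] => by simp [graftAux, pruneAux]
    | a :: l => by
      have h₁ := sum_prune_grow (fun b => F (b :: l)) a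
      have h₂ := sum_pruneAux_graftAux (fun m => F (a :: m)) l
      have h₃ : ((graftList (node []) a).map fun q => ((pruneAux (q :: l)).map F).sum) =
          (graftList (node []) a).map fun q => ((pruneList q).map fun b => F (b :: l)).sum +
            ((pruneAux l).map fun m => F (q :: m)).sum := by
        refine List.map_congr_left fun q hq => ?_
        simp [pruneAux_cons, ne_leaf_of_mem_graftList hq, Function.comp_def]
      have h₄ : ((pruneAux l).map fun m =>
            ((graftList (node []) a).map fun b => F (b :: m)).sum).sum =
          ((graftList (node []) a).map fun b => ((pruneAux l).map fun m => F (b :: m)).sum).sum := by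
        simpa using Multiset.sum_map_sum_map (pruneAux l : Multiset (List PlanarTree))
          (graftList (node []) a : Multiset PlanarTree) (f := fun m b => F (b :: m))
      have h₅ : ((graftAux (node []) l).map fun m =>
            ((pruneList a).map fun b => F (b :: m)).sum).sum =
          ((pruneList a).map fun b =>
            ((graftAux (node []) l).map fun m => F (b :: m)).sum).sum := by
        simpa using Multiset.sum_map_sum_map (graftAux (node []) l : Multiset (List PlanarTree))
          (pruneList a : Multiset PlanarTree) (f := fun m b => F (b :: m))
      have h₆ : ((graftAux (node []) l).map fun m =>
            ((if a = node [] then [m] else []).map F).sum).sum =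
          ((if a = node [] then [l] else []).map fun m =>
            ((graftAux (node []) m).map F).sum).sum := by
        split_ifs <;> simp
      simp only [growList] at h₁
      simp only [graftAux, List.map_append, List.map_map, List.sum_append, Function.comp_def, h₃]
      simp only [pruneAux_cons, graftAux, List.map_append, List.map_map, List.sum_append,
        Function.comp_def, List.sum_map_add, h₁, h₂, h₄, h₅, h₆, List.map_cons, List.sum_cons,
        add_smul]
      abel
end

end Commutator

mutual
  theorem size_of_mem_graftList (s : PlanarTree) : ∀ t : PlanarTree, ∀ u ∈ graftList s t,
      u.size = t.size + s.size
    | node l, u, h => by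
      simp only [graftList, List.mem_cons, List.mem_map] at h
      rcases h with rfl | ⟨m, hm, rfl⟩
      · simp [size_node]; ring
      · simp [size_node, size_of_mem_graftAux s l m hm]; ring
  theorem size_of_mem_graftAux (s : PlanarTree) : ∀ l : List PlanarTree, ∀ m ∈ graftAux s l,
      (m.map size).sum = (l.map size).sum + s.size
    | [], m, h => by simp [graftAux] at h
    | a :: l, m, h => by
      simp only [graftAux, List.mem_append, List.mem_map] at h
      rcases h with ⟨b, hb, rfl⟩ | ⟨m, hm, rfl⟩
      · simp [size_of_mem_graftList s a b hb]; ring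
      · simp [size_of_mem_graftAux s l m hm]; ring
end

mutual
  theorem iso_refl : ∀ t : PlanarTree, Iso t t
    | node l => .node (List.Perm.refl l) (forall₂_iso_refl l)
  theorem forall₂_iso_refl : ∀ l : List PlanarTree, List.Forall₂ Iso l l
    | [] => .nil
    | a :: l => .cons (iso_refl a) (forall₂_iso_refl l)
end

/-- A function on planar trees and a function on planar forests are both isomorphism
invariant, as soon as the second is invariant under permutations and determines the first,
and replacing the head of a forest by an equivalent tree is harmless. -/
theorem eq_of_iso {α β : Type*} {f : PlanarTree → α} {g : List PlanarTree → β}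
    (hperm : ∀ {l m}, List.Perm l m → g l = g m)
    (hnode : ∀ {l m}, RTree.mk (node l) = RTree.mk (node m) → g l = g m →
      f (node l) = f (node m))
    (hcons : ∀ {a b l m}, Iso a b → f a = f b → List.Forall₂ Iso l m → g l = g m →
      g (a :: l) = g (b :: m))
    {s t : PlanarTree} (h : Iso s t) : f s = f t :=
  Iso.rec (motive_1 := fun s t _ => f s = f t) (motive_2 := fun l m _ => g l = g m)
    (fun hp hf ih => hnode (Quotient.sound (.rel _ _ (.node hp hf))) ((hperm hp).trans ih))
    rfl (fun hab hlm ih₁ ih₂ => hcons hab ih₁ hlm ih₂) h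

theorem mk_eq_of_iso {s t : PlanarTree} (h : Iso s t) : RTree.mk s = RTree.mk t :=
  Quotient.sound (.rel _ _ h)

theorem eq_of_mk_eq {α : Type*} {f : PlanarTree → α} (hf : ∀ {s t}, Iso s t → f s = f t)
    {s t : PlanarTree} (h : RTree.mk s = RTree.mk t) : f s = f t := by
  induction Quotient.exact h with
  | rel _ _ h' => exact hf h'
  | refl => rfl
  | symm _ _ _ ih => exact (ih (Quotient.sound ‹_›)).symm
  | trans _ _ _ h₁ h₂ ih₁ ih₂ => exact (ih₁ (Quotient.sound h₁)).trans (ih₂ (Quotient.sound h₂))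

theorem size_eq_of_mk_eq {s t : PlanarTree} (h : RTree.mk s = RTree.mk t) :
    s.size = t.size :=
  eq_of_mk_eq (eq_of_iso (g := fun l => (l.map size).sum)
    (fun h => (h.map _).sum_eq) (fun _ h => by simpa [size_node] using h)
    (fun _ h₁ _ h₂ => by simp_all)) h

theorem mk_node_perm {l m : List PlanarTree} (h : l.Perm m) :
    RTree.mk (node l) = RTree.mk (node m) :=
  mk_eq_of_iso (.node h (forall₂_iso_refl m))

theorem mk_node_cons_congr {a b : PlanarTree} (l : List PlanarTree)
    (h : RTree.mk a = RTree.mk b) :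
    RTree.mk (node (a :: l)) = RTree.mk (node (b :: l)) :=
  eq_of_mk_eq (f := fun a => RTree.mk (node (a :: l)))
    (fun h => mk_eq_of_iso (.node (List.Perm.refl _) (.cons h (forall₂_iso_refl l)))) h

theorem mk_node_append_congr {l m : List PlanarTree} (h : l.map RTree.mk = m.map RTree.mk)
    (r : List PlanarTree) : RTree.mk (node (l ++ r)) = RTree.mk (node (m ++ r)) := by
  induction l generalizing m r with
  | nil => cases m <;> simp_all
  | cons a l ih =>
    cases m with
    | nil => simp at h
    | cons b m =>
      simp only [List.map_cons, List.cons.injEq] at h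
      calc RTree.mk (node (a :: l ++ r)) = RTree.mk (node (b :: (l ++ r))) :=
            mk_node_cons_congr _ h.1
        _ = RTree.mk (node (l ++ b :: r)) := mk_node_perm List.perm_middle.symm
        _ = RTree.mk (node (m ++ b :: r)) := ih h.2 _
        _ = RTree.mk (node (b :: m ++ r)) := mk_node_perm List.perm_middle

/-- The multiset of isomorphism classes of the trees of a planar forest. -/
def classes (l : List PlanarTree) : Multiset RTree := (l.map RTree.mk : List RTree)

/-- The rooted tree with the given principal branches. -/
noncomputable def join (s : Multiset RTree) : RTree := RTree.mk (node (s.toList.map RTree.rep))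

theorem mk_rep (T : RTree) : RTree.mk T.rep = T := Quotient.out_eq T

theorem mk_node (l : List PlanarTree) : RTree.mk (node l) = join (classes l) := by
  have h : List.Perm ((classes l).toList) (l.map RTree.mk) :=
    Multiset.coe_eq_coe.1 (Multiset.coe_toList _)
  obtain ⟨m, hm, hml⟩ : ∃ m, List.Perm m l ∧ m.map RTree.mk = (classes l).toList := by
    obtain ⟨m, h₁, h₂⟩ := (congrFun₂ (List.eq_map_comp_perm RTree.mk) _ _).mpr h
    exact ⟨m, h₂, h₁.symm⟩
  rw [← mk_node_perm hm, join]
  have := mk_node_append_congr (l := m) (m := (classes l).toList.map RTree.rep)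
    (by simp [hml, Function.comp_def, mk_rep]) []
  simpa using this

theorem classes_cons (a : PlanarTree) (l : List PlanarTree) :
    classes (a :: l) = RTree.mk a ::ₘ classes l := rfl

theorem classes_perm {l m : List PlanarTree} (h : l.Perm m) : classes l = classes m :=
  Multiset.coe_eq_coe.2 (h.map _)

theorem classes_forall₂ {l m : List PlanarTree} (h : List.Forall₂ Iso l m) :
    classes l = classes m := by
  induction h with
  | nil => rfl
  | cons h _ ih => rw [classes_cons, classes_cons, mk_eq_of_iso h, ih]

/-- The isomorphism classes of the trees obtained by adding a terminal vertex to a tree. -/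
def growClasses (t : PlanarTree) : Multiset RTree := classes (growList t)

/-- The isomorphism classes of the trees obtained by deleting a terminal vertex of a tree. -/
def pruneClasses (t : PlanarTree) : Multiset RTree := classes (pruneList t)

/-- The isomorphism classes of the forests obtained by adding a terminal vertex, as a child of
some vertex, to a forest. -/
def growAuxClasses (l : List PlanarTree) : Multiset (Multiset RTree) :=
  ((graftAux (node []) l).map classes : List _)

/-- The isomorphism classes of the forests obtained by deleting a terminal vertex of a forest. -/
def pruneAuxClasses (l : List PlanarTree) : Multiset (Multiset RTree) :=
  ((pruneAux l).map classes : List _)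

theorem growAuxClasses_cons (a : PlanarTree) (l : List PlanarTree) :
    growAuxClasses (a :: l) = (growClasses a).map (· ::ₘ classes l) +
      (growAuxClasses l).map (RTree.mk a ::ₘ ·) := by
  simp [growAuxClasses, growClasses, graftAux, growList, classes, Function.comp_def]

theorem pruneAuxClasses_cons (a : PlanarTree) (l : List PlanarTree) :
    pruneAuxClasses (a :: l) = (if a = node [] then {classes l} else 0) +
      (pruneClasses a).map (· ::ₘ classes l) + (pruneAuxClasses l).map (RTree.mk a ::ₘ ·) := by
  split_ifs with h <;>
  simp [pruneAuxClasses, pruneClasses, pruneAux_cons, classes, Function.comp_def, h]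

theorem growAuxClasses_perm {l m : List PlanarTree} (h : l.Perm m) :
    growAuxClasses l = growAuxClasses m := by
  induction h with
  | nil => rfl
  | cons a h ih => rw [growAuxClasses_cons, growAuxClasses_cons, ih, classes_perm h]
  | swap a b l =>
    simp only [growAuxClasses_cons, Multiset.map_add, Multiset.map_map, Function.comp_def,
      classes_cons, Multiset.cons_swap]
    abel
  | trans _ _ ih₁ ih₂ => exact ih₁.trans ih₂

theorem pruneAuxClasses_perm {l m : List PlanarTree} (h : l.Perm m) :
    pruneAuxClasses l = pruneAuxClasses m := by
  induction h with
  | nil => rfl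
  | cons a h ih => rw [pruneAuxClasses_cons, pruneAuxClasses_cons, ih, classes_perm h]
  | swap a b l =>
    simp only [pruneAuxClasses_cons, Multiset.map_add, Multiset.map_map, Function.comp_def,
      classes_cons, Multiset.cons_swap]
    split_ifs <;> simp only [Multiset.map_singleton, Multiset.map_zero] <;> abel
  | trans _ _ ih₁ ih₂ => exact ih₁.trans ih₂

theorem growClasses_node (l : List PlanarTree) :
    growClasses (node l) = RTree.mk (node (node [] :: l)) ::ₘ (growAuxClasses l).map join := by
  simp [growClasses, growAuxClasses, growList, graftList, classes_cons]
  simp [classes, Function.comp_def, mk_node]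

theorem pruneClasses_node (l : List PlanarTree) :
    pruneClasses (node l) = (pruneAuxClasses l).map join := by
  simp [pruneClasses, pruneAuxClasses, pruneList]
  simp [classes, Function.comp_def, mk_node]

theorem eq_leaf_iff_of_iso {s t : PlanarTree} (h : Iso s t) : s = node [] ↔ t = node [] := by
  obtain ⟨hp, hf⟩ := h
  constructor
  · rintro ⟨⟩
    obtain rfl := hp.nil_eq
    cases hf
    rfl
  · rintro ⟨⟩
    cases hf
    rw [hp.eq_nil]

theorem growClasses_congr {s t : PlanarTree} (h : RTree.mk s = RTree.mk t) :
    growClasses s = growClasses t := by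
  refine eq_of_mk_eq (fun h => ?_) h
  refine eq_of_iso (g := fun l => (growAuxClasses l, classes l)) (fun h => ?_) (fun _ h => ?_)
    (fun h₁ h₂ h₃ h₄ => ?_) h
  · rw [growAuxClasses_perm h, classes_perm h]
  · simp_all [growClasses_node, mk_node, classes_cons]
  · simp_all [growAuxClasses_cons, classes_cons, mk_eq_of_iso h₁]

theorem pruneClasses_congr {s t : PlanarTree} (h : RTree.mk s = RTree.mk t) :
    pruneClasses s = pruneClasses t := by
  refine eq_of_mk_eq (eq_of_iso (g := pruneAuxClasses) pruneAuxClasses_perm (fun _ h => ?_)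
    (fun h₁ h₂ h₃ h₄ => ?_)) h
  · rw [pruneClasses_node, pruneClasses_node, h]
  · simp only [pruneAuxClasses_cons, eq_leaf_iff_of_iso h₁, mk_eq_of_iso h₁, classes_forall₂ h₃, h₂, h₄]

end PlanarTree

section Operators

open PlanarTree

variable (k : Type*) [Semiring k]

theorem growF_mk (t : PlanarTree) :
    growF k (RTree.mk t) =
      (t.growList.map fun p => Finsupp.single (RTree.mk p) (1 : k)).sum := by
  have h := congrArg (fun s => (s.map fun T => Finsupp.single T (1 : k)).sum)
    (growClasses_congr (mk_rep (RTree.mk t)))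
  simpa [growF, growClasses, classes, Function.comp_def] using h

theorem pruneF_mk (t : PlanarTree) :
    pruneF k (RTree.mk t) =
      (t.pruneList.map fun p => Finsupp.single (RTree.mk p) (1 : k)).sum := by
  have h := congrArg (fun s => (s.map fun T => Finsupp.single T (1 : k)).sum)
    (pruneClasses_congr (mk_rep (RTree.mk t)))
  simpa [pruneF, pruneClasses, classes, Function.comp_def] using h

theorem Grow_single_mk (t : PlanarTree) :
    Grow k (Finsupp.single (RTree.mk t) 1) =
      (t.growList.map fun p => Finsupp.single (RTree.mk p) (1 : k)).sum := by
  simp [Grow, growF_mk]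

theorem Prune_single_mk (t : PlanarTree) :
    Prune k (Finsupp.single (RTree.mk t) 1) =
      (t.pruneList.map fun p => Finsupp.single (RTree.mk p) (1 : k)).sum := by
  simp [Prune, pruneF_mk]

theorem Diag_single_mk (t : PlanarTree) :
    Diag k (Finsupp.single (RTree.mk t) 1) =
      t.size • Finsupp.single (RTree.mk t) (1 : k) := by
  simp [Diag, RTree.size, size_eq_of_mk_eq (mk_rep (RTree.mk t))]

theorem Prune_mul_Grow : Prune k * Grow k = Grow k * Prune k + Diag k := by
  refine Finsupp.lhom_ext' fun T => LinearMap.ext_ring ?_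
  obtain ⟨t, rfl⟩ : ∃ t, RTree.mk t = T := ⟨_, mk_rep T⟩
  simp only [LinearMap.comp_apply, Finsupp.lsingle_apply, Module.End.mul_apply,
    LinearMap.add_apply, Grow_single_mk, Prune_single_mk, Diag_single_mk, map_list_sum,
    List.map_map, Function.comp_def]
  exact sum_prune_grow (fun t => Finsupp.single (RTree.mk t) (1 : k)) t

theorem Diag_mul_Grow : Diag k * Grow k = Grow k * Diag k + Grow k := by
  refine Finsupp.lhom_ext' fun T => LinearMap.ext_ring ?_
  obtain ⟨t, rfl⟩ : ∃ t, RTree.mk t = T := ⟨_, mk_rep T⟩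
  simp only [LinearMap.comp_apply, Finsupp.lsingle_apply, Module.End.mul_apply,
    LinearMap.add_apply, Grow_single_mk, Diag_single_mk, map_list_sum, map_nsmul,
    List.map_map, Function.comp_def]
  rw [← succ_nsmul, List.smul_sum, List.map_map]
  refine congrArg List.sum (List.map_congr_left fun u hu => ?_)
  rw [size_of_mem_graftList _ _ _ hu]
  simp [size_node]

theorem Diag_Grow_pow_bullet (n : ℕ) :
    Diag k ((Grow k ^ n) (Finsupp.single RTree.bullet 1)) =
      (n + 1) • (Grow k ^ n) (Finsupp.single RTree.bullet 1) := by
  induction n with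
  | zero => simpa [size_node, RTree.bullet] using Diag_single_mk k (node [])
  | succ n ih =>
    rw [pow_succ', Module.End.mul_apply, ← Module.End.mul_apply, Diag_mul_Grow,
      LinearMap.add_apply, Module.End.mul_apply, ih, map_nsmul, ← succ_nsmul]

theorem Prune_Grow_pow_succ_bullet (n : ℕ) :
    Prune k ((Grow k ^ (n + 1)) (Finsupp.single RTree.bullet 1)) =
      (n + 2).choose 2 • (Grow k ^ n) (Finsupp.single RTree.bullet 1) := by
  induction n with
  | zero =>
    have h₁ := LinearMap.congr_fun (Prune_mul_Grow k) (Finsupp.single RTree.bullet 1)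
    have h₂ := Prune_single_mk k (node [])
    have h₃ := Diag_Grow_pow_bullet k 0
    simp_all [RTree.bullet, pruneList, pruneAux]
  | succ n ih =>
    rw [pow_succ', Module.End.mul_apply, ← Module.End.mul_apply, Prune_mul_Grow,
      LinearMap.add_apply, Module.End.mul_apply, ih, map_nsmul, Diag_Grow_pow_bullet,
      ← Module.End.mul_apply, ← pow_succ', ← add_nsmul, Nat.choose_succ_succ' (n + 2) 1,
      Nat.choose_one_right, add_comm]

end Operators

/-- The naturally grown forest `f_n = 𝔑^{n-1}(•)` is an eigenvector of
`𝔓∘𝔑` with eigenvalue `C(n+1,2)`: `𝔓(𝔑^n(•)) = C(n+1,2)·𝔑^{n-1}(•)`. -/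
theorem stmt17 (k : Type*) [Field k] [CharZero k] (n : ℕ) (hn : 1 ≤ n) :
    Prune k ((Grow k ^ n) (Finsupp.single RTree.bullet 1))
      = (((n + 1).choose 2 : ℕ) : k) • (Grow k ^ (n - 1)) (Finsupp.single RTree.bullet 1) := by
  obtain ⟨m, rfl⟩ := Nat.exists_eq_add_of_le' hn
  rw [Prune_Grow_pow_succ_bullet, Nat.cast_smul_eq_nsmul]
  rfl
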